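/- arXiv:2307.06591 — 5 statements merged into one kernel-verified Lean document; each statement's English description precedes it below -/
import Mathlib

section
/- For every integer d ≥ 1, the d-th upper triangular Pascal matrix Q_d is unipotent with a single Jordan block: (Q_d − 1)^d = 0, and the kernel of Q_d − 1, viewed as a linear endomorphism of ℝ^d, is one-dimensional (it is spanned by the first standard basis vector). -/
open Matrix

/-- An upper triangular unipotent `d × d` real matrix: all entries below the
diagonal vanish and all diagonal entries equal `1`. -/
def UTUnipotent {d : ℕ} (u : Matrix (Fin d) (Fin d) ℝ) : Prop :=
  (∀ i j : Fin d, (j : ℕ) < (i : ℕ) → u i j = 0) ∧ ∀ i : Fin d, u i i = 1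

/-- A (square, upper triangular unipotent) matrix is totally positive if all of
its non-trivial minors are positive: for all strictly increasing index tuples
`I J : Fin k → Fin d` with `I p ≤ J p` for all `p`, the corresponding minor is
positive. -/
def TotallyPositive {d : ℕ} (u : Matrix (Fin d) (Fin d) ℝ) : Prop :=
  ∀ k : ℕ, 1 ≤ k → k ≤ d → ∀ I J : Fin k → Fin d,
    StrictMono I → StrictMono J → (∀ p, I p ≤ J p) → 0 < (u.submatrix I J).det

/-- A (square, upper triangular unipotent) matrix is totally nonnegative if all
of its non-trivial minors are nonnegative. -/
def TotallyNonneg {d : ℕ} (u : Matrix (Fin d) (Fin d) ℝ) : Prop :=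
  ∀ k : ℕ, 1 ≤ k → k ≤ d → ∀ I J : Fin k → Fin d,
    StrictMono I → StrictMono J → (∀ p, I p ≤ J p) → 0 ≤ (u.submatrix I J).det

/-- The `d`-th upper triangular Pascal matrix: its `(i,j)` entry (`0`-indexed)
is `C(j,i)` when `i ≤ j` and `0` otherwise. -/
def pascal (d : ℕ) : Matrix (Fin d) (Fin d) ℝ :=
  Matrix.of fun i j => if (i : ℕ) ≤ (j : ℕ) then ((j : ℕ).choose (i : ℕ) : ℝ) else 0

/-- A tuple `I : Fin k → Fin d` is consecutive if `I p = I 0 + p` for all `p`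
(stated symmetrically so that it also makes sense for `k = 0`). -/
def Consecutive {d k : ℕ} (I : Fin k → Fin d) : Prop :=
  ∀ p q : Fin k, (I p : ℕ) + (q : ℕ) = (I q : ℕ) + (p : ℕ)

/-- The row indices `(0, 1, …, k-1)` of the top-right corner `k × k` minor. -/
def cornerI {d : ℕ} (k : ℕ) (hk : k ≤ d) : Fin k → Fin d :=
  fun p => ⟨(p : ℕ), lt_of_lt_of_le p.isLt hk⟩

/-- The column indices `(d-k, d-k+1, …, d-1)` of the top-right corner `k × k`
minor. -/
def cornerJ {d : ℕ} (k : ℕ) (hk : k ≤ d) : Fin k → Fin d :=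
  fun p => ⟨d - k + (p : ℕ), by have h := p.isLt; omega⟩

/-- A strictly upper triangular matrix of size `d` has vanishing `d`-th power. -/
theorem Matrix.pow_eq_zero_of_strictly_upper {R : Type*} [CommRing R] {d : ℕ}
    {N : Matrix (Fin d) (Fin d) R} (hN : ∀ i j, j ≤ i → N i j = 0) : N ^ d = 0 := by
  have h := N.aeval_self_charpoly
  rw [charpoly_of_isUpperTriangular N fun i j hij => hN i j (le_of_lt hij)] at h
  simpa [hN _ _ le_rfl] using h

/-- A vector in the kernel of a strictly upper triangular matrix with nonzero superdiagonal
vanishes away from the first coordinate. -/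
theorem Matrix.eq_zero_of_mulVec_eq_zero_of_strictly_upper {R : Type*} [CommRing R]
    [NoZeroDivisors R] {d : ℕ} {N : Matrix (Fin d) (Fin d) R} (hN : ∀ i j, j ≤ i → N i j = 0)
    (hs : ∀ i j : Fin d, (j : ℕ) = i + 1 → N i j ≠ 0) {v : Fin d → R} (hv : N *ᵥ v = 0)
    (j : Fin d) (hj : (j : ℕ) ≠ 0) : v j = 0 := by
  induction j using WellFoundedGT.induction with
  | ind j ih =>
    let i : Fin d := ⟨j - 1, by omega⟩
    have hij : (j : ℕ) = i + 1 := by simp only [i]; omega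
    have hrow : ∑ k, N i k * v k = 0 := congrFun hv i
    rw [Finset.sum_eq_single j] at hrow
    · exact (mul_eq_zero.mp hrow).resolve_left (hs i j hij)
    · intro k _ hkj
      rcases lt_or_gt_of_ne hkj with hk | hk
      · rw [hN i k (by rw [Fin.lt_def] at hk; rw [Fin.le_def]; omega), zero_mul]
      · rw [ih k hk (by rw [Fin.lt_def] at hk; omega), mul_zero]
    · simp

/-- The kernel of a strictly upper triangular matrix with nonzero superdiagonal is spanned by the
first standard basis vector. -/
theorem Matrix.ker_toLin'_of_strictly_upper {R : Type*} [CommRing R] [NoZeroDivisors R] {d : ℕ}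
    (hd : 0 < d) {N : Matrix (Fin d) (Fin d) R} (hN : ∀ i j, j ≤ i → N i j = 0)
    (hs : ∀ i j : Fin d, (j : ℕ) = i + 1 → N i j ≠ 0) :
    LinearMap.ker (Matrix.toLin' N) =
      Submodule.span R {(Pi.single (⟨0, hd⟩ : Fin d) (1 : R) : Fin d → R)} := by
  ext v
  rw [LinearMap.mem_ker, toLin'_apply, Submodule.mem_span_singleton]
  constructor
  · intro hv
    refine ⟨v ⟨0, hd⟩, funext fun j => ?_⟩
    rcases eq_or_ne j ⟨0, hd⟩ with rfl | hj
    · simp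
    · rw [eq_zero_of_mulVec_eq_zero_of_strictly_upper hN hs hv j fun h => hj (Fin.ext h)]
      simp [hj]
  · rintro ⟨c, rfl⟩
    ext i
    simp [mulVec_smul, hN i ⟨0, hd⟩ (Nat.zero_le _)]

theorem pascal_sub_one_apply_of_le {d : ℕ} (i j : Fin d) (hij : j ≤ i) :
    (pascal d - 1) i j = 0 := by
  rcases hij.eq_or_lt with rfl | h
  · simp [pascal]
  · simp [pascal, h.ne', h]

theorem pascal_sub_one_apply_succ_ne_zero {d : ℕ} (i j : Fin d) (hij : (j : ℕ) = i + 1) :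
    (pascal d - 1) i j ≠ 0 := by
  have hne : i ≠ j := fun h => by simp [h] at hij
  rw [Matrix.sub_apply, one_apply_ne hne, sub_zero]
  simp only [pascal, of_apply, hij, Nat.le_succ, if_true, Nat.choose_succ_self_right]
  exact Nat.cast_ne_zero.mpr (Nat.succ_ne_zero _)

/-- For every `d ≥ 1`, the Pascal matrix `Q_d` is unipotent
with a single Jordan block: `(Q_d - 1) ^ d = 0` and the kernel of `Q_d - 1`
(as a linear endomorphism of `ℝ^d`) is one-dimensional, spanned by the first
standard basis vector. -/
theorem pascal_unipotent_single_jordan_block (d : ℕ) (hd : 1 ≤ d) :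
    (pascal d - 1) ^ d = 0 ∧
    LinearMap.ker (Matrix.toLin' (pascal d - 1)) =
      Submodule.span ℝ {(Pi.single (⟨0, hd⟩ : Fin d) (1 : ℝ) : Fin d → ℝ)} ∧
    Module.finrank ℝ (LinearMap.ker (Matrix.toLin' (pascal d - 1))) = 1 := by
  have hker := ker_toLin'_of_strictly_upper hd pascal_sub_one_apply_of_le
    pascal_sub_one_apply_succ_ne_zero
  refine ⟨pow_eq_zero_of_strictly_upper pascal_sub_one_apply_of_le, hker, ?_⟩
  rw [hker]
  exact finrank_span_singleton (by simp)
end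

section
/- For every integer d ≥ 1, the d-th upper triangular Pascal matrix Q_d is totally positive: every non-trivial minor of Q_d is positive. -/
open Matrix

theorem Matrix.det_of_sum_column {n α R : Type*} [Fintype n] [DecidableEq n] [DecidableEq α]
    [CommRing R] (f : n → α → R) (S : n → Finset α) :
    (Matrix.of fun p q => ∑ t ∈ S q, f p t).det =
      ∑ t ∈ Fintype.piFinset S, (Matrix.of fun p q => f p (t q)).det := by
  have h := (Matrix.detRowAlternating (n := n) (R := R)).toMultilinearMap.map_sum_finset
    (fun _ t p => f p t) S
  have h1 : (Matrix.of fun p q => ∑ t ∈ S q, f p t).det =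
      (Matrix.of fun q p => ∑ t ∈ S q, f p t).det := by
    rw [← Matrix.det_transpose]; rfl
  have h2 : ∀ t : n → α, (Matrix.of fun p q => f p (t q)).det =
      (Matrix.of fun q p => f p (t q)).det := by
    intro t
    rw [← Matrix.det_transpose]; rfl
  rw [h1]
  simp only [h2]
  refine Eq.trans ?_ h
  change Matrix.det _ = Matrix.det _
  congr 1
  ext q p
  simp

theorem Nat.cast_choose_succ_sub_eq_sum_Ico {R : Type*} [Ring R] (i : ℕ) {a b : ℕ} (h : a ≤ b) :
    ((b.choose (i + 1) : R) - a.choose (i + 1)) = ∑ t ∈ Finset.Ico a b, (t.choose i : R) := by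
  induction b, h using Nat.le_induction with
  | base => simp
  | succ b hb ih =>
    rw [Finset.sum_Ico_succ_top hb, ← ih, Nat.choose_succ_succ]
    push_cast
    abel

/-- If every minor of `f` with strictly increasing columns is nonnegative, then so is the
determinant obtained by summing the columns of `f` over successive disjoint intervals, and it is
positive as soon as the minor on the right end points is. -/
theorem Matrix.det_sum_Ico_nonneg_and_pos {k : ℕ} (f : Fin k → ℕ → ℝ) (a b : Fin k → ℕ)
    (hab : ∀ q, a q < b q) (hba : ∀ q r, q < r → b q ≤ a r)
    (hf : ∀ t : Fin k → ℕ, StrictMono t → 0 ≤ (Matrix.of fun p q => f p (t q)).det) :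
    0 ≤ (Matrix.of fun p q => ∑ t ∈ Finset.Ico (a q) (b q), f p t).det ∧
      (0 < (Matrix.of fun p q => f p (b q - 1)).det →
        0 < (Matrix.of fun p q => ∑ t ∈ Finset.Ico (a q) (b q), f p t).det) := by
  rw [Matrix.det_of_sum_column]
  have hnonneg : ∀ t ∈ Fintype.piFinset fun q => Finset.Ico (a q) (b q),
      0 ≤ (Matrix.of fun p q => f p (t q)).det := by
    intro t ht
    simp only [Fintype.mem_piFinset, Finset.mem_Ico] at ht
    exact hf t fun q r hqr => (ht q).2.trans_le ((hba q r hqr).trans (ht r).1)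
  refine ⟨Finset.sum_nonneg hnonneg, fun hpos => ?_⟩
  refine Finset.sum_pos' hnonneg ⟨fun q => b q - 1, ?_, hpos⟩
  simp only [Fintype.mem_piFinset, Finset.mem_Ico]
  intro q
  have := hab q
  omega

theorem Matrix.det_choose_nonneg_and_pos (k : ℕ) (I J : Fin k → ℕ)
    (hI : StrictMono I) (hJ : StrictMono J) :
    0 ≤ (Matrix.of fun p q => ((J q).choose (I p) : ℝ)).det ∧
      ((∀ p, I p ≤ J p) → 0 < (Matrix.of fun p q => ((J q).choose (I p) : ℝ)).det) := by
  induction k with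
  | zero => simp
  | succ k ihk =>
    obtain ⟨m, hm⟩ : ∃ m, I 0 = m := ⟨_, rfl⟩
    have hJs : ∀ q : Fin k, J q.castSucc < J q.succ := fun q => hJ q.castSucc_lt_succ
    induction m generalizing I J with
    | zero =>
      have hpos : ∀ p : Fin k, 0 < I p.succ := fun p =>
        (Nat.zero_le _).trans_lt (hI p.succ_pos)
      have hdet : (Matrix.of fun p q => ((J q).choose (I p) : ℝ)).det =
          (Matrix.of fun p q : Fin k => ∑ t ∈ Finset.Ico (J q.castSucc) (J q.succ),
            (t.choose (I p.succ - 1) : ℝ)).det := by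
        rw [Matrix.det_eq_of_forall_col_eq_smul_add_pred
          (B := Matrix.of fun p => Fin.cons ((J 0).choose (I p) : ℝ) fun q : Fin k =>
            ((J q.succ).choose (I p) : ℝ) - (J q.castSucc).choose (I p))
          (fun _ => 1) (by simp) (by simp), Matrix.det_succ_row_zero, Fin.sum_univ_succ]
        simp only [Matrix.of_apply, hm, Fin.cons_zero, Fin.cons_succ, Nat.choose_zero_right,
          sub_self, mul_zero, zero_mul, Finset.sum_const_zero, add_zero, Nat.cast_one,
          Fin.val_zero, pow_zero, mul_one, one_mul]
        congr 1
        ext p q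
        have h := Nat.cast_choose_succ_sub_eq_sum_Ico (R := ℝ) (I p.succ - 1) (hJs q).le
        rw [Nat.sub_add_cancel (hpos p)] at h
        simpa using h
      have hI' : StrictMono fun p : Fin k => I p.succ - 1 := fun p r hpr => by
        have h1 := hI (Fin.succ_lt_succ_iff.2 hpr)
        have h2 := hpos p
        dsimp only
        omega
      have hba : ∀ q r : Fin k, q < r → J q.succ ≤ J r.castSucc := fun q r hqr =>
        hJ.monotone (Fin.succ_le_castSucc_iff.2 hqr)
      have key := Matrix.det_sum_Ico_nonneg_and_pos
        (fun (p : Fin k) t => (t.choose (I p.succ - 1) : ℝ))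
        (fun q => J q.castSucc) (fun q => J q.succ) hJs hba
        (fun t ht => (ihk _ t hI' ht).1)
      rw [hdet]
      refine ⟨key.1, fun hIJ => key.2 ((ihk _ _ hI' fun q r hqr => ?_).2 fun p => ?_)⟩
      · have h1 := hba q r hqr
        have h2 := hJs q
        have h3 := hJs r
        omega
      · exact Nat.sub_le_sub_right (hIJ p.succ) 1
    | succ m ihm =>
      have hpos : ∀ p, 0 < I p := fun p => by
        have := hI.monotone (Fin.zero_le p)
        omega
      have hI' : StrictMono fun p => I p - 1 := fun p r hpr => by
        have h1 := hI hpr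
        have h2 := hpos p
        dsimp only
        omega
      by_cases hJ0 : J 0 = 0
      · have hdet : (Matrix.of fun p q => ((J q).choose (I p) : ℝ)).det = 0 :=
          Matrix.det_eq_zero_of_column_eq_zero 0 fun p => by
            simp [hJ0, Nat.choose_eq_zero_of_lt (hpos p)]
        refine ⟨hdet.ge, fun hIJ => ?_⟩
        have := hIJ 0
        omega
      let a : Fin (k + 1) → ℕ := Fin.cons 0 fun q : Fin k => J q.castSucc
      have hab : ∀ q, a q < J q := Fin.cases (Nat.pos_of_ne_zero hJ0) hJs
      have hba : ∀ q r, q < r → J q ≤ a r := fun q r => by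
        refine Fin.cases (fun h => absurd h (Fin.not_lt_zero q)) (fun r h => ?_) r
        exact hJ.monotone (Fin.le_castSucc_iff.2 h)
      have hdet : (Matrix.of fun p q => ((J q).choose (I p) : ℝ)).det =
          (Matrix.of fun p q => ∑ t ∈ Finset.Ico (a q) (J q),
            (t.choose (I p - 1) : ℝ)).det := by
        have hsum : ∀ p q, ∑ t ∈ Finset.Ico (a q) (J q), (t.choose (I p - 1) : ℝ) =
            (J q).choose (I p) - (a q).choose (I p) := fun p q => by
          have h := Nat.cast_choose_succ_sub_eq_sum_Ico (R := ℝ) (I p - 1) (hab q).le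
          rw [Nat.sub_add_cancel (hpos p)] at h
          exact h.symm
        refine Matrix.det_eq_of_forall_col_eq_smul_add_pred (fun _ => 1) (fun p => ?_)
          fun p q => ?_
        · simp [hsum, a, Nat.choose_eq_zero_of_lt (hpos p)]
        · simp [hsum, a]
      have ih := fun (t : Fin (k + 1) → ℕ) (ht : StrictMono t) =>
        ihm (fun p => I p - 1) t hI' ht (by simp [hm]) fun q => ht q.castSucc_lt_succ
      have key := Matrix.det_sum_Ico_nonneg_and_pos
        (fun p t => (t.choose (I p - 1) : ℝ)) a J hab hba (fun t ht => (ih t ht).1)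
      rw [hdet]
      refine ⟨key.1, fun hIJ => key.2 ((ih _ fun q r hqr => ?_).2 fun p => ?_)⟩
      · have h1 := hba q r hqr
        have h2 := hab q
        have h3 := hab r
        omega
      · exact Nat.sub_le_sub_right (hIJ p) 1

theorem pascal_apply (d : ℕ) (i j : Fin d) : pascal d i j = ((j : ℕ).choose i : ℝ) := by
  rw [pascal, Matrix.of_apply]
  split_ifs with h
  · rfl
  · rw [Nat.choose_eq_zero_of_lt (not_le.1 h), Nat.cast_zero]

/-- For every `d ≥ 1`, the Pascal matrix `Q_d` is totally
positive: every non-trivial minor of `Q_d` is positive. -/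
theorem pascal_totallyPositive (d : ℕ) (hd : 1 ≤ d) :
    TotallyPositive (pascal d) := by
  intro k _ _ I J hI hJ hIJ
  have hmat : (pascal d).submatrix I J =
      Matrix.of fun p q => (((J q : ℕ)).choose (I p : ℕ) : ℝ) := by
    ext p q
    exact pascal_apply d (I p) (J q)
  rw [hmat]
  exact (Matrix.det_choose_nonneg_and_pos k (fun p => I p) (fun q => J q) hI hJ).2 hIJ
end

section
/- If u and v are d×d real upper triangular unipotent matrices that are both totally positive, then the product u·v is totally positive. In other words, the totally positive upper triangular unipotent matrices form a sub-semigroup under matrix multiplication. -/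
open Matrix

/-- The product of two upper triangular unipotent matrices is upper triangular unipotent. -/
theorem UTUnipotent.mul {d : ℕ} {u v : Matrix (Fin d) (Fin d) ℝ}
    (hu : UTUnipotent u) (hv : UTUnipotent v) : UTUnipotent (u * v) := by
  refine ⟨fun i j hij => ?_, fun i => ?_⟩
  · rw [Matrix.mul_apply]
    refine Finset.sum_eq_zero fun l _ => ?_
    rcases lt_or_ge (l : ℕ) i with h | h
    · rw [hu.1 i l h, zero_mul]
    · rw [hv.1 l j (hij.trans_le h), mul_zero]
  · rw [Matrix.mul_apply, Finset.sum_eq_single i, hu.2, hv.2, mul_one]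
    · intro l _ hl
      rcases lt_or_gt_of_ne (Fin.val_ne_of_ne hl) with h | h
      · rw [hu.1 i l h, zero_mul]
      · rw [hv.1 l i h, mul_zero]
    · simp

/-- A square matrix with a zero block in rows `≥ p` and columns `≤ p` is singular. -/
theorem Matrix.det_eq_zero_of_lower_left_block {R : Type*} [CommRing R] {k : ℕ}
    (M : Matrix (Fin k) (Fin k) R) (p : Fin k)
    (h : ∀ i j, p ≤ i → j ≤ p → M i j = 0) : M.det = 0 := by
  rw [Matrix.det_apply]
  refine Finset.sum_eq_zero fun σ _ => ?_
  obtain ⟨j, hj, hσ⟩ : ∃ j ≤ p, p ≤ σ j := by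
    by_contra! hc
    have hcard := Finset.card_le_card_of_injOn (s := Finset.Iic p) (t := Finset.Iio p) σ
      (fun j hj => by simpa using hc j (by simpa using hj)) σ.injective.injOn
    simp at hcard
  rw [Finset.prod_eq_zero (f := fun i => M (σ i) i) (Finset.mem_univ j) (h _ _ hσ hj), smul_zero]

/-- A trivial minor of an upper triangular unipotent matrix vanishes. -/
theorem UTUnipotent.det_submatrix_eq_zero {d k : ℕ} {u : Matrix (Fin d) (Fin d) ℝ}
    (hu : UTUnipotent u) {I J : Fin k → Fin d} (hI : StrictMono I) (hJ : StrictMono J)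
    (h : ¬∀ p, I p ≤ J p) : (u.submatrix I J).det = 0 := by
  push Not at h
  obtain ⟨p, hp⟩ := h
  exact Matrix.det_eq_zero_of_lower_left_block _ p fun i j hi hj =>
    hu.1 _ _ ((hJ.monotone hj).trans_lt (hp.trans_le (hI.monotone hi)))

/-- All minors with increasing indices of a totally positive upper triangular unipotent matrix
are nonnegative. -/
theorem TotallyPositive.det_submatrix_nonneg {d k : ℕ} {u : Matrix (Fin d) (Fin d) ℝ}
    (hu' : TotallyPositive u) (hu : UTUnipotent u) (hk : 1 ≤ k) (hkd : k ≤ d)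
    {I J : Fin k → Fin d} (hI : StrictMono I) (hJ : StrictMono J) :
    0 ≤ (u.submatrix I J).det := by
  by_cases h : ∀ p, I p ≤ J p
  · exact (hu' k hk hkd I J hI hJ h).le
  · exact (hu.det_submatrix_eq_zero hI hJ h).ge

/-- Expansion of the determinant of a product of rectangular matrices along the columns of the
first factor. -/
theorem Matrix.det_mul_eq_sum_det_submatrix_mul_prod {m n R : Type*} [Fintype m] [DecidableEq m]
    [Fintype n] [DecidableEq n] [CommRing R] (A : Matrix m n R) (B : Matrix n m R) :
    (A * B).det = ∑ p : m → n, (A.submatrix id p).det * ∏ i, B (p i) i := by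
  simp only [Matrix.det_apply', Matrix.mul_apply, Finset.prod_univ_sum, Finset.mul_sum,
    Fintype.piFinset_univ, Finset.sum_mul, Matrix.submatrix_apply, id_eq]
  rw [Finset.sum_comm]
  simp only [Finset.prod_mul_distrib, mul_assoc]

/-- The Cauchy–Binet formula, summed over all index tuples rather than increasing ones. -/
theorem Matrix.factorial_smul_det_mul {m n R : Type*} [Fintype m] [DecidableEq m]
    [Fintype n] [DecidableEq n] [CommRing R] (A : Matrix m n R) (B : Matrix n m R) :
    (Fintype.card m).factorial • (A * B).det =
      ∑ p : m → n, (A.submatrix id p).det * (B.submatrix p id).det := by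
  have key (σ : Equiv.Perm m) : (A * B).det =
      ∑ p : m → n, (A.submatrix id p).det * ((Equiv.Perm.sign σ : ℤ) * ∏ i, B (p (σ i)) i) := by
    rw [Matrix.det_mul_eq_sum_det_submatrix_mul_prod]
    refine (Fintype.sum_equiv (σ.arrowCongr (Equiv.refl n)).symm _ _ fun p => ?_).symm
    have h := Matrix.det_permute' σ (A.submatrix id p)
    rw [Matrix.submatrix_submatrix] at h
    change _ = (A.submatrix id (p ∘ σ)).det * ∏ i, B (p (σ i)) i
    rw [show (A.submatrix id (p ∘ σ)).det = _ from h]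
    ring
  rw [← Fintype.card_perm, ← Finset.card_univ, ← Finset.sum_const,
    Finset.sum_congr rfl fun σ _ => key σ, Finset.sum_comm]
  simp only [Matrix.det_apply' (B.submatrix _ id), Finset.mul_sum, Matrix.submatrix_apply, id_eq]

/-- The product of two minors sharing an index tuple is invariant under permuting that tuple. -/
theorem Matrix.det_submatrix_mul_det_submatrix_comp_perm {m n R : Type*} [Fintype m]
    [DecidableEq m] [CommRing R] (A : Matrix m n R) (B : Matrix n m R) (p : m → n)
    (σ : Equiv.Perm m) :
    (A.submatrix id (p ∘ σ)).det * (B.submatrix (p ∘ σ) id).det =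
      (A.submatrix id p).det * (B.submatrix p id).det := by
  have hA : (A.submatrix id (p ∘ σ)).det = _ := Matrix.det_permute' σ (A.submatrix id p)
  have hB : (B.submatrix (p ∘ σ) id).det = _ := Matrix.det_permute σ (B.submatrix p id)
  have hs : ((Equiv.Perm.sign σ : ℤ) : R) * (Equiv.Perm.sign σ : ℤ) = 1 := by
    rw [← Int.cast_mul, ← Units.val_mul, Int.units_mul_self, Units.val_one, Int.cast_one]
  rw [hA, hB, mul_mul_mul_comm, hs, one_mul]

/-- The totally positive upper triangular unipotent matrices
form a sub-semigroup: the product of two such matrices is again upper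
triangular unipotent and totally positive. -/
theorem totallyPositive_mul {d : ℕ} (u v : Matrix (Fin d) (Fin d) ℝ)
    (hu : UTUnipotent u) (hv : UTUnipotent v)
    (hu' : TotallyPositive u) (hv' : TotallyPositive v) :
    UTUnipotent (u * v) ∧ TotallyPositive (u * v) := by
  refine ⟨hu.mul hv, fun k hk hkd I J hI hJ hIJ => ?_⟩
  have hsum := Matrix.factorial_smul_det_mul (u.submatrix I id) (v.submatrix id J)
  rw [← Matrix.submatrix_mul u v I id J Function.bijective_id] at hsum
  rw [nsmul_eq_mul] at hsum
  refine pos_of_mul_pos_right (hsum ▸ ?_) (Nat.cast_nonneg (Fintype.card (Fin k)).factorial)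
  refine Finset.sum_pos' (fun p _ => ?_) ⟨I, Finset.mem_univ _, ?_⟩
  · by_cases hp : Function.Injective p
    · rw [← Matrix.det_submatrix_mul_det_submatrix_comp_perm _ _ p (Tuple.sort p)]
      have hq : StrictMono (p ∘ Tuple.sort p) :=
        (Tuple.monotone_sort p).strictMono_of_injective (hp.comp (Tuple.sort p).injective)
      exact mul_nonneg (hu'.det_submatrix_nonneg hu hk hkd hI hq)
        (hv'.det_submatrix_nonneg hv hk hkd hq hJ)
    · obtain ⟨i, j, hij, hne⟩ := Function.not_injective_iff.mp hp
      rw [Matrix.det_zero_of_column_eq hne (fun l => by simp [hij]), zero_mul]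
  · exact mul_pos (hu' k hk hkd I I hI hI fun _ => le_rfl) (hv' k hk hkd I J hI hJ hIJ)
end

section
/- Let u be a d×d real totally nonnegative upper triangular unipotent matrix and let 1 ≤ k ≤ d. Suppose that every non-trivial ℓ×ℓ minor of u is positive for all ℓ < k. If every non-trivial k×k minor det(u.submatrix I J) of u with both I and J consecutive is positive, then every non-trivial k×k minor of u is positive. -/
open Matrix

/-- Cramer's rule, evaluated against a linear functional on the row space. -/
lemma det_mul_apply_eq_sum_updateRow {n : ℕ} (A : Matrix (Fin n) (Fin n) ℝ)
    (g : (Fin n → ℝ) →ₗ[ℝ] ℝ) (z : Fin n → ℝ) :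
    A.det * g z = ∑ i, (A.updateRow i z).det * g (A i) := by
  have h := congrArg g (mulVec_cramer Aᵀ z)
  rw [det_transpose, map_smul, smul_eq_mul, mulVec_eq_sum, map_sum] at h
  rw [← h]
  refine Finset.sum_congr rfl fun i _ => ?_
  simp only [op_smul_eq_smul, transpose_transpose, map_smul, smul_eq_mul, cramer_transpose_apply]

/-- A three-term Plücker relation: row `q.castSucc`, row `q.succ` and the additional row `z`
play the roles of the three exchanged rows. -/
lemma det_mul_det_updateRow {n : ℕ} (A : Matrix (Fin (n + 1)) (Fin (n + 1)) ℝ) (q : Fin n)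
    (c : Fin n → Fin (n + 1)) (z : Fin (n + 1) → ℝ) :
    A.det * ((A.submatrix q.castSucc.succAbove c).updateRow q (z ∘ c)).det =
      (A.updateRow q.castSucc z).det *
        ((A.submatrix q.castSucc.succAbove c).updateRow q (A q.castSucc ∘ c)).det +
      (A.updateRow q.succ z).det * (A.submatrix q.castSucc.succAbove c).det := by
  set B := A.submatrix q.castSucc.succAbove c
  let g : (Fin (n + 1) → ℝ) →ₗ[ℝ] ℝ :=
    { toFun := fun x => (B.updateRow q (x ∘ c)).det
      map_add' := fun x y => det_updateRow_add B q (x ∘ c) (y ∘ c)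
      map_smul' := fun a x => det_updateRow_smul B q a (x ∘ c) }
  have hB (j : Fin n) : A (q.castSucc.succAbove j) ∘ c = B j := rfl
  have h := det_mul_apply_eq_sum_updateRow A g z
  rw [Fin.sum_univ_succAbove _ q.castSucc, Finset.sum_eq_single q] at h
  · have hq : g (A (q.castSucc.succAbove q)) = B.det := by
      change (B.updateRow q (A (q.castSucc.succAbove q) ∘ c)).det = _
      rw [hB, updateRow_eq_self]
    rw [hq, Fin.succAbove_castSucc_self] at h
    exact h
  · intro j _ hj
    refine mul_eq_zero_of_right _ ?_
    change (B.updateRow q (A (q.castSucc.succAbove j) ∘ c)).det = 0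
    rw [hB]
    exact det_updateRow_eq_zero hj
  · simp

lemma submatrix_update_left {m n α β : Type*} [DecidableEq m] (u : Matrix α β ℝ)
    (I : m → α) (J : n → β) (i : m) (r : α) :
    u.submatrix (Function.update I i r) J = (u.submatrix I J).updateRow i (u r ∘ J) := by
  ext a b
  by_cases h : a = i
  · subst h; simp
  · simp [h]

/-- Trivial minors of an upper triangular matrix vanish. -/
lemma det_submatrix_eq_zero_of_lt {d k : ℕ} (u : Matrix (Fin d) (Fin d) ℝ)
    (h0 : ∀ i j : Fin d, j < i → u i j = 0) {I J : Fin k → Fin d} (hI : StrictMono I)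
    (hJ : StrictMono J) {p : Fin k} (hp : J p < I p) : (u.submatrix I J).det = 0 := by
  rw [det_apply]
  refine Finset.sum_eq_zero fun σ _ => ?_
  obtain ⟨i, hi, hσ⟩ : ∃ i ≤ p, p ≤ σ i := by
    by_contra! h
    have := Finset.card_le_card_of_injOn (s := Finset.Iic p) (t := Finset.Iio p) σ
      (fun i hi => by simpa using h i (by simpa using hi)) σ.injective.injOn
    simp at this
  rw [Finset.prod_eq_zero (Finset.mem_univ i), smul_zero]
  exact h0 _ _ (((hJ.monotone hi).trans_lt hp).trans_le (hI.monotone hσ))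

lemma strictMono_update {n : ℕ} {α : Type*} [Preorder α] {I : Fin n → α}
    (hI : StrictMono I) (i : Fin n) (r : α) (hlt : ∀ j < i, I j < r) (hgt : ∀ j > i, r < I j) :
    StrictMono (Function.update I i r) := by
  intro a b hab
  rcases eq_or_ne a i with rfl | ha
  · simpa [hab.ne'] using hgt b hab
  · rcases eq_or_ne b i with rfl | hb
    · simpa [ha] using hlt a hab
    · simpa [ha, hb] using hI hab

lemma consecutive_of_forall_succ {d n : ℕ} {I : Fin (n + 1) → Fin d}
    (h : ∀ q : Fin n, (I q.succ : ℕ) = I q.castSucc + 1) : Consecutive I := by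
  have h0 (p : Fin (n + 1)) : (I p : ℕ) = I 0 + p := by
    induction p using Fin.induction with
    | zero => simp
    | succ q ih => rw [h, ih, Fin.val_castSucc, Fin.val_succ]; omega
  intro p q
  rw [h0 p, h0 q]
  omega

/-- For a fixed column tuple, positivity of the minors with consecutive rows implies
positivity of all non-trivial minors. -/
lemma minors_pos_of_consecutive_rows {d n : ℕ} (u : Matrix (Fin d) (Fin d) ℝ)
    (h0 : ∀ i j : Fin d, j < i → u i j = 0)
    (hnn : ∀ I J : Fin (n + 1) → Fin d, StrictMono I → StrictMono J → (∀ p, I p ≤ J p) →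
      0 ≤ (u.submatrix I J).det)
    (hpos : ∀ I J : Fin n → Fin d, StrictMono I → StrictMono J → (∀ p, I p ≤ J p) →
      0 < (u.submatrix I J).det)
    (J : Fin (n + 1) → Fin d) (hJ : StrictMono J)
    (hcons : ∀ I : Fin (n + 1) → Fin d, Consecutive I → (∀ p, I p ≤ J p) →
      0 < (u.submatrix I J).det)
    (I : Fin (n + 1) → Fin d) (hI : StrictMono I) (hIJ : ∀ p, I p ≤ J p) :
    0 < (u.submatrix I J).det := by
  induction hs : ∑ p, (I p : ℕ) using Nat.strong_induction_on generalizing I with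
  | _ s ih =>
  by_cases hgap : ∀ q : Fin n, (I q.succ : ℕ) = I q.castSucc + 1
  · exact hcons I (consecutive_of_forall_succ hgap) hIJ
  push Not at hgap
  obtain ⟨q, hq⟩ := hgap
  have hlt : I q.castSucc < I q.succ := hI q.castSucc_lt_succ
  obtain ⟨r, hr1, hr2⟩ : ∃ r, I q.castSucc < r ∧ r < I q.succ := by
    refine ⟨⟨I q.castSucc + 1, ?_⟩, ?_, ?_⟩ <;> simp only [Fin.lt_def] at * <;> omega
  have hbelow {j : Fin (n + 1)} (hj : j < q.succ) : I j < r :=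
    (hI.monotone (Fin.le_castSucc_iff.2 hj)).trans_lt hr1
  have habove {j : Fin (n + 1)} (hj : q.castSucc < j) : r < I j :=
    hr2.trans_le (hI.monotone (Fin.castSucc_lt_iff_succ_le.1 hj))
  set c := q.castSucc.succAbove with hc
  have hcmono : StrictMono c := Fin.strictMono_succAbove _
  have hcq : c q = q.succ := Fin.succAbove_castSucc_self q
  have hclt {j : Fin n} (hj : j < q) : c j < q.castSucc := by
    rw [hc, Fin.succAbove_of_castSucc_lt _ _ (by simpa using hj)]
    simpa using hj
  have hlow : StrictMono (Function.update I q.succ r) :=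
    strictMono_update hI _ _ (fun j hj => hbelow hj)
      fun j hj => habove (q.castSucc_lt_succ.trans hj)
  have hhigh : StrictMono (Function.update I q.castSucc r) :=
    strictMono_update hI _ _ (fun j hj => hbelow (hj.trans q.castSucc_lt_succ))
      fun j hj => habove hj
  have hle {m : ℕ} {K L : Fin m → Fin d} (i : Fin m) (x : Fin d) (h : ∀ p, K p ≤ L p)
      (hx : x ≤ K i) (p : Fin m) : Function.update K i x p ≤ L p := by
    rcases eq_or_ne p i with rfl | hp
    · simpa using hx.trans (h p)
    · simpa [hp] using h p
  have hlowpos : 0 < (u.submatrix (Function.update I q.succ r) J).det := by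
    refine ih _ ?_ _ hlow (hle _ _ hIJ hr2.le) rfl
    rw [← hs]
    refine Finset.sum_lt_sum (fun p _ => ?_) ⟨q.succ, Finset.mem_univ _, ?_⟩
    · exact hle _ _ (fun _ => le_rfl) hr2.le p
    · simpa using hr2
  have hhighnn : 0 ≤ (u.submatrix (Function.update I q.castSucc r) J).det := by
    by_cases h : ∀ p, Function.update I q.castSucc r p ≤ J p
    · exact hnn _ _ hhigh hJ h
    · push Not at h
      obtain ⟨p, hp⟩ := h
      exact (det_submatrix_eq_zero_of_lt u h0 hhigh hJ hp).ge
  have hsub : 0 < (u.submatrix (I ∘ c) (J ∘ c)).det :=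
    hpos _ _ (hI.comp hcmono) (hJ.comp hcmono) fun p => hIJ _
  have hupd (x : Fin d) (hx : x < I q.succ) (hx' : I q.castSucc ≤ x) :
      0 < (u.submatrix (Function.update (I ∘ c) q x) (J ∘ c)).det := by
    refine hpos _ _ (strictMono_update (hI.comp hcmono) _ _ (fun j hj => ?_) fun j hj => ?_)
      (hJ.comp hcmono) (hle _ _ (fun p => hIJ _) ?_)
    · exact (hI (hclt hj)).trans_le hx'
    · exact hx.trans (hcq ▸ hI (hcmono hj))
    · simpa [hcq] using hx.le
  have key := det_mul_det_updateRow (u.submatrix I J) q c (u r ∘ J)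
  have hrow := hupd (I q.castSucc) hlt le_rfl
  have hnew := hupd r hr2 hr1.le
  rw [submatrix_update_left] at hlowpos hhighnn hrow hnew
  refine pos_of_mul_pos_left ?_ hnew.le
  refine lt_of_lt_of_eq ?_ key.symm
  exact add_pos_of_nonneg_of_pos (mul_nonneg hhighnn hrow.le) (mul_pos hlowpos hsub)

/-- Reflecting a matrix in its antidiagonal transposes and reverses its minors. -/
lemma det_submatrix_antitranspose {d k : ℕ} (u : Matrix (Fin d) (Fin d) ℝ)
    (I J : Fin k → Fin d) :
    ((u.submatrix Fin.rev Fin.rev)ᵀ.submatrix I J).det =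
      (u.submatrix (Fin.rev ∘ J ∘ Fin.rev) (Fin.rev ∘ I ∘ Fin.rev)).det := by
  rw [← det_transpose, ← det_submatrix_equiv_self Fin.revPerm]
  rfl

lemma strictMono_rev_comp_rev {d k : ℕ} {I : Fin k → Fin d} (hI : StrictMono I) :
    StrictMono (Fin.rev ∘ I ∘ Fin.rev) :=
  fun _ _ h => Fin.rev_lt_rev.2 (hI (Fin.rev_lt_rev.2 h))

lemma Consecutive.rev_comp_rev {d k : ℕ} {I : Fin k → Fin d} (hI : Consecutive I) :
    Consecutive (Fin.rev ∘ I ∘ Fin.rev) := by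
  intro p q
  have := hI p.rev q.rev
  simp only [Function.comp_apply, Fin.val_rev] at *
  omega

/-- Lemma A.1 of the paper. Let `u` be a totally nonnegative
upper triangular unipotent matrix and `1 ≤ k ≤ d`. Suppose every non-trivial
`ℓ × ℓ` minor of `u` with `ℓ < k` is positive. If every non-trivial `k × k`
minor of `u` with consecutive row and column tuples is positive, then every
non-trivial `k × k` minor of `u` is positive. -/
theorem minors_pos_of_consecutive_minors_pos {d : ℕ}
    (u : Matrix (Fin d) (Fin d) ℝ) (hu : UTUnipotent u) (hnn : TotallyNonneg u)
    (k : ℕ) (hk1 : 1 ≤ k) (hk2 : k ≤ d)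
    (hsmall : ∀ ℓ : ℕ, ℓ < k → ∀ I J : Fin ℓ → Fin d,
      StrictMono I → StrictMono J → (∀ p, I p ≤ J p) →
      0 < (u.submatrix I J).det)
    (hcons : ∀ I J : Fin k → Fin d, Consecutive I → Consecutive J →
      (∀ p, I p ≤ J p) → 0 < (u.submatrix I J).det) :
    ∀ I J : Fin k → Fin d, StrictMono I → StrictMono J →
      (∀ p, I p ≤ J p) → 0 < (u.submatrix I J).det := by
  obtain ⟨n, rfl⟩ : ∃ n, k = n + 1 := ⟨k - 1, by omega⟩
  have hnn' := hnn (n + 1) hk1 hk2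
  have hpos := hsmall n n.lt_succ_self
  intro I J hI hJ hIJ
  refine minors_pos_of_consecutive_rows u hu.1 hnn' hpos J hJ (fun I hI hIJ => ?_) I hI hIJ
  have hImono : StrictMono I := fun p q hpq => by
    have := hI p q
    simp only [Fin.lt_def] at *
    omega
  have h := minors_pos_of_consecutive_rows (u.submatrix Fin.rev Fin.rev)ᵀ
    (fun i j hij => hu.1 _ _ (Fin.rev_lt_rev.2 hij))
    (fun K L hK hL hKL => by
      rw [det_submatrix_antitranspose]
      exact hnn' _ _ (strictMono_rev_comp_rev hL) (strictMono_rev_comp_rev hK)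
        fun p => Fin.rev_le_rev.2 (hKL _))
    (fun K L hK hL hKL => by
      rw [det_submatrix_antitranspose]
      exact hpos _ _ (strictMono_rev_comp_rev hL) (strictMono_rev_comp_rev hK)
        fun p => Fin.rev_le_rev.2 (hKL _))
    (Fin.rev ∘ I ∘ Fin.rev) (strictMono_rev_comp_rev hImono)
    (fun K hK hKI => by
      rw [det_submatrix_antitranspose]
      refine hcons _ _ ?_ hK.rev_comp_rev fun p => Fin.rev_le_rev.2 (hKI _)
      exact hI.rev_comp_rev.rev_comp_rev)
    (Fin.rev ∘ J ∘ Fin.rev) (strictMono_rev_comp_rev hJ) fun p => Fin.rev_le_rev.2 (hIJ _)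
  rw [det_submatrix_antitranspose] at h
  simpa [Function.comp_def] using h
end

section
/- Let u be a d×d real totally nonnegative upper triangular unipotent matrix and let 1 ≤ k ≤ d. Suppose that every non-trivial ℓ×ℓ minor of u is positive for all ℓ < k, and that there exists a non-trivial k×k minor det(u.submatrix I J) of u with both I and J consecutive such that det(u.submatrix I J) = 0. Then the top-right corner k×k minor of u vanishes: det(u.submatrix I₀ J₀) = 0, where I₀ = (0, 1, …, k−1) and J₀ = (d−k, d−k+1, …, d−1) (0-indexed). -/
open Matrix

namespace Matrix

/-- The Desnanot–Jacobi identity multiplied by the determinant of the matrix. -/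
theorem det_mul_desnanot_jacobi {R : Type*} [CommRing R] {n : ℕ}
    (A : Matrix (Fin (n + 2)) (Fin (n + 2)) R) :
    A.det * (A.det *
        (A.submatrix (fun p : Fin n => p.succ.castSucc) (fun p => p.succ.castSucc)).det) =
      A.det * ((A.submatrix Fin.succ Fin.succ).det * (A.submatrix Fin.castSucc Fin.castSucc).det -
        (A.submatrix Fin.succ Fin.castSucc).det * (A.submatrix Fin.castSucc Fin.succ).det) := by
  have hne : (0 : Fin (n + 2)) ≠ Fin.last (n + 1) := Fin.last_pos.ne
  let l := Fin.last (n + 1)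
  let X : Matrix (Fin (n + 2)) (Fin (n + 2)) R :=
    ((1 : Matrix _ _ R).updateRow 0 (A.adjugate 0)).updateRow l (A.adjugate l)
  have hX : X.det = A.adjugate 0 0 * A.adjugate l l - A.adjugate 0 l * A.adjugate l 0 := by
    let U : Matrix (Fin (n + 2)) (Fin 2) R :=
      of fun i => ![(Pi.single 0 1 : Fin (n + 2) → R) i, (Pi.single l 1 : Fin (n + 2) → R) i]
    let V : Matrix (Fin 2) (Fin (n + 2)) R :=
      of ![A.adjugate 0 - Pi.single 0 1, A.adjugate l - Pi.single l 1]
    have : X = 1 + U * V := by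
      ext i j
      by_cases h0 : i = 0
      · subst h0
        simp [X, U, V, l, Matrix.mul_apply, updateRow_apply, hne, Matrix.one_apply, Pi.single_apply,
          eq_comm]
      · by_cases hl : i = l
        · subst hl
          simp [X, U, V, l, Matrix.mul_apply, updateRow_apply, hne.symm, Matrix.one_apply,
            Pi.single_apply, eq_comm]
        · simp [X, U, V, Matrix.mul_apply, updateRow_apply, h0, hl]
    rw [this, det_one_add_mul_comm, det_fin_two]
    simp only [Matrix.add_apply, Matrix.mul_apply]
    simp [U, V, Pi.single_apply, l, hne, hne.symm]
  have hXA : X * A = (A.updateRow 0 (A.det • Pi.single 0 1)).updateRow l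
      (A.det • Pi.single l 1) := by
    have key : ∀ i j, ∑ x, A.adjugate i x * A x j = A.det * (Pi.single i 1 : _ → R) j := by
      intro i j
      have := congrFun (congrFun (adjugate_mul A) i) j
      simpa [Matrix.mul_apply, Matrix.one_apply, Pi.single_apply, eq_comm] using this
    ext i j
    by_cases hl : i = l
    · subst hl
      simp [X, Matrix.mul_apply, updateRow_apply, key]
    · by_cases h0 : i = 0
      · subst h0
        simp [X, Matrix.mul_apply, updateRow_apply, hl, key]
      · simp [X, Matrix.mul_apply, updateRow_apply, h0, hl, Matrix.one_apply]
  have hinner : ((A.updateRow 0 (Pi.single 0 1)).updateRow l (Pi.single l 1)).det =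
      (A.submatrix (fun p : Fin n => p.succ.castSucc) (fun p => p.succ.castSucc)).det := by
    rw [← adjugate_apply, adjugate_fin_succ_eq_det_submatrix]
    have : (A.updateRow 0 (Pi.single 0 1)).submatrix l.succAbove l.succAbove =
        (A.submatrix Fin.castSucc Fin.castSucc).updateRow 0 (Pi.single 0 1) := by
      ext i j
      simp [l, updateRow_apply, Pi.single_apply]
    rw [this, ← adjugate_apply, adjugate_fin_succ_eq_det_submatrix]
    simp [← two_mul, submatrix_submatrix, Function.comp_def]
  have hdet := congrArg det hXA
  rw [det_mul, hX, det_updateRow_smul, updateRow_comm _ hne, det_updateRow_smul,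
    updateRow_comm _ hne.symm, hinner] at hdet
  simp only [adjugate_fin_succ_eq_det_submatrix, l, Fin.succAbove_zero, Fin.succAbove_last] at hdet
  rw [← hdet]
  have hs : ((-1 : R) ^ (n + 1)) * (-1) ^ (n + 1) = 1 := by
    rw [← mul_pow]; simp
  simp only [Fin.val_zero, Fin.val_last, zero_add, add_zero, pow_zero, one_mul,
    pow_add (-1 : R) (n + 1)]
  linear_combination (A.det * ((A.submatrix Fin.succ Fin.succ).det *
    (A.submatrix Fin.castSucc Fin.castSucc).det -
      (A.submatrix Fin.succ Fin.castSucc).det * (A.submatrix Fin.castSucc Fin.succ).det)) * hs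

/-- **Desnanot–Jacobi identity** (Dodgson condensation). -/
theorem desnanot_jacobi {R : Type*} [CommRing R] {n : ℕ}
    (A : Matrix (Fin (n + 2)) (Fin (n + 2)) R) :
    A.det * (A.submatrix (fun p : Fin n => p.succ.castSucc) (fun p => p.succ.castSucc)).det =
      (A.submatrix Fin.succ Fin.succ).det * (A.submatrix Fin.castSucc Fin.castSucc).det -
        (A.submatrix Fin.succ Fin.castSucc).det * (A.submatrix Fin.castSucc Fin.succ).det := by
  have generic := mul_left_cancel₀ (det_mvPolynomialX_ne_zero (Fin (n + 2)) ℤ)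
    (det_mul_desnanot_jacobi (mvPolynomialX (Fin (n + 2)) (Fin (n + 2)) ℤ))
  have eval_X := mvPolynomialX_map_eval₂ (Int.castRingHom R) A
  let φ := MvPolynomial.eval₂Hom (Int.castRingHom R) fun p : Fin (n + 2) × Fin (n + 2) => A p.1 p.2
  have hφ : (mvPolynomialX (Fin (n + 2)) (Fin (n + 2)) ℤ).map φ = A := eval_X
  have := congrArg φ generic
  simpa only [map_mul, map_sub, RingHom.map_det, RingHom.mapMatrix_apply, ← submatrix_map, hφ]
    using this

end Matrix

section
variable {d n : ℕ} {w : ℕ → ℕ → ℝ}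

/-- The consecutive `n × n` minor of the array `w` with top-left entry at `(i, j)`. -/
noncomputable def consecutiveMinor (w : ℕ → ℕ → ℝ) (n i j : ℕ) : ℝ :=
  (of fun p q : Fin n => w (i + p) (j + q)).det

theorem consecutiveMinor_self (hlow : ∀ i j, j < i → w i j = 0) (hdiag : ∀ i < d, w i i = 1)
    {i : ℕ} (hi : i + n ≤ d) : consecutiveMinor w n i i = 1 := by
  unfold consecutiveMinor
  rw [det_of_isUpperTriangular]
  · exact Finset.prod_eq_one fun p _ => hdiag _ (by omega)
  · intro p q hpq
    exact hlow _ _ (by have : (q : ℕ) < p := hpq; omega)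

theorem consecutiveMinor_succ_right_eq_zero
    (hlow : ∀ i j, j < i → w i j = 0) (hdiag : ∀ i < d, w i i = 1)
    (hnn : ∀ (m : ℕ) (I J : Fin m → ℕ), StrictMono I → StrictMono J → (∀ p, I p ≤ J p) →
      (∀ p, J p < d) → 0 ≤ (of fun p q => w (I p) (J q)).det)
    (hpos : ∀ (I J : Fin n → ℕ), StrictMono I → StrictMono J → (∀ p, I p ≤ J p) →
      (∀ p, J p < d) → 0 < (of fun p q => w (I p) (J q)).det)
    {i j : ℕ} (hij : i ≤ j) (hj : j + n + 1 < d) (hz : consecutiveMinor w (n + 1) i j = 0) :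
    consecutiveMinor w (n + 1) i (j + 1) = 0 := by
  have hlt : i < j := by
    refine hij.lt_of_ne ?_
    rintro rfl
    rw [consecutiveMinor_self hlow hdiag (by omega)] at hz
    exact one_ne_zero hz
  let I : Fin (n + 2) → ℕ := fun p => if (p : ℕ) ≤ n then i + p else j + n
  let J : Fin (n + 2) → ℕ := fun q => j + q
  let M : Matrix (Fin (n + 2)) (Fin (n + 2)) ℝ := of fun p q => w (I p) (J q)
  have hI : StrictMono I := by
    intro p q hpq
    have : (p : ℕ) < q := hpq
    simp only [I]
    split_ifs <;> omega
  have hJ : StrictMono J := fun p q hpq => Nat.add_lt_add_left hpq j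
  have hM : 0 ≤ M.det := hnn _ I J hI hJ
    (fun p => by simp only [I, J]; split_ifs <;> omega) (fun p => by simp only [J]; omega)
  have hinner :
      0 < (M.submatrix (fun p : Fin n => p.succ.castSucc) (fun p => p.succ.castSucc)).det := by
    refine hpos (fun p => I p.succ.castSucc) (fun p => J p.succ.castSucc)
      (fun p q h => hI (by simpa using h)) (fun p q h => hJ (by simpa using h)) (fun p => ?_)
      (fun p => ?_)
    · simp only [I, J, Fin.val_castSucc, Fin.val_succ]
      split_ifs <;> omega
    · simp only [J, Fin.val_castSucc, Fin.val_succ]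
      omega
  have hcorner : 0 < (M.submatrix Fin.succ Fin.castSucc).det := by
    rw [det_succ_row _ (Fin.last n), Finset.sum_eq_single (Fin.last n)]
    · have hentry : M.submatrix Fin.succ Fin.castSucc (Fin.last n) (Fin.last n) = 1 := by
        simpa [M, I, J] using hdiag (j + n) (by omega)
      rw [hentry, ← two_mul, pow_mul, neg_one_sq, one_pow, one_mul, one_mul]
      refine hpos (fun p => I ((Fin.last n).succAbove p).succ)
        (fun q => J ((Fin.last n).succAbove q).castSucc) (fun p q h => hI (by simpa using h))
        (fun p q h => hJ (by simpa using h)) (fun p => ?_) (fun p => ?_)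
      · simp only [I, J, Fin.succAbove_last, Fin.val_castSucc, Fin.val_succ]
        split_ifs <;> omega
      · simp only [J, Fin.succAbove_last, Fin.val_castSucc]
        omega
    · intro q _ hq
      have hq' : (q : ℕ) < n := Fin.val_lt_last hq
      have hentry : M.submatrix Fin.succ Fin.castSucc (Fin.last n) q = 0 := by
        simpa [M, I, J] using hlow (j + n) (j + q) (by omega)
      rw [hentry, mul_zero, zero_mul]
    · simp
  have hleft : (M.submatrix Fin.castSucc Fin.castSucc).det = 0 := by
    rw [← hz, consecutiveMinor]
    congr 1
    ext p q
    simp [M, I, J, Nat.le_of_lt_succ p.isLt]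
  have hright :
      (M.submatrix Fin.castSucc Fin.succ).det = consecutiveMinor w (n + 1) i (j + 1) := by
    rw [consecutiveMinor]
    congr 1
    ext p q
    simp [M, I, J, Nat.le_of_lt_succ p.isLt, add_assoc, add_comm 1]
  have hnonneg : 0 ≤ consecutiveMinor w (n + 1) i (j + 1) :=
    hnn (n + 1) (fun p => i + p) (fun q => j + 1 + q)
      (fun p q h => Nat.add_lt_add_left h _) (fun p q h => Nat.add_lt_add_left h _)
      (fun p => by omega) (fun p => by omega)
  have key := desnanot_jacobi M
  rw [hleft, hright] at key
  nlinarith [mul_nonneg hM hinner.le, mul_nonneg hcorner.le hnonneg]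

theorem consecutiveMinor_of_succ_left_eq_zero
    (hlow : ∀ i j, j < i → w i j = 0) (hdiag : ∀ i < d, w i i = 1)
    (hnn : ∀ (m : ℕ) (I J : Fin m → ℕ), StrictMono I → StrictMono J → (∀ p, I p ≤ J p) →
      (∀ p, J p < d) → 0 ≤ (of fun p q => w (I p) (J q)).det)
    (hpos : ∀ (I J : Fin n → ℕ), StrictMono I → StrictMono J → (∀ p, I p ≤ J p) →
      (∀ p, J p < d) → 0 < (of fun p q => w (I p) (J q)).det)
    {i j : ℕ} (hij : i + 1 ≤ j) (hj : j + n < d) (hz : consecutiveMinor w (n + 1) (i + 1) j = 0) :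
    consecutiveMinor w (n + 1) i j = 0 := by
  have hlt : i + 1 < j := by
    refine hij.lt_of_ne ?_
    rintro rfl
    rw [consecutiveMinor_self hlow hdiag (by omega)] at hz
    exact one_ne_zero hz
  let I : Fin (n + 2) → ℕ := fun p => i + p
  let J : Fin (n + 2) → ℕ := fun q => if (q : ℕ) = 0 then i + 1 else j + q - 1
  let M : Matrix (Fin (n + 2)) (Fin (n + 2)) ℝ := of fun p q => w (I p) (J q)
  have hI : StrictMono I := fun p q hpq => Nat.add_lt_add_left hpq i
  have hJ : StrictMono J := by
    intro p q hpq
    have : (p : ℕ) < q := hpq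
    simp only [J]
    split_ifs <;> omega
  have hM : 0 ≤ M.det := hnn _ I J hI hJ
    (fun p => by simp only [I, J]; split_ifs <;> omega)
    (fun p => by simp only [J]; split_ifs <;> omega)
  have hinner :
      0 < (M.submatrix (fun p : Fin n => p.succ.castSucc) (fun p => p.succ.castSucc)).det := by
    refine hpos (fun p => I p.succ.castSucc) (fun p => J p.succ.castSucc)
      (fun p q h => hI (by simpa using h)) (fun p q h => hJ (by simpa using h)) (fun p => ?_)
      (fun p => ?_)
    · simp only [I, J, Fin.val_castSucc, Fin.val_succ, Nat.add_one_ne_zero, if_false]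
      omega
    · simp only [J, Fin.val_castSucc, Fin.val_succ, Nat.add_one_ne_zero, if_false]
      omega
  have hcorner : 0 < (M.submatrix Fin.succ Fin.castSucc).det := by
    rw [det_succ_column_zero, Finset.sum_eq_single 0]
    · have hentry : M.submatrix Fin.succ Fin.castSucc 0 0 = 1 := by
        simpa [M, I, J] using hdiag (i + 1) (by omega)
      rw [hentry, Fin.val_zero, pow_zero, one_mul, one_mul]
      refine hpos (fun p => I ((0 : Fin (n + 1)).succAbove p).succ)
        (fun q => J q.succ.castSucc) (fun p q h => hI (by simpa using h))
        (fun p q h => hJ (by simpa using h)) (fun p => ?_) (fun p => ?_)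
      · simp only [I, J, Fin.succAbove_zero, Fin.val_castSucc, Fin.val_succ,
          Nat.add_one_ne_zero, if_false]
        omega
      · simp only [J, Fin.val_castSucc, Fin.val_succ, Nat.add_one_ne_zero, if_false]
        omega
    · intro p _ hp
      have hp' : 0 < (p : ℕ) := Fin.pos_iff_ne_zero.2 hp
      have hentry : M.submatrix Fin.succ Fin.castSucc p 0 = 0 := by
        simpa [M, I, J] using hlow (i + (p + 1)) (i + 1) (by omega)
      rw [hentry, mul_zero, zero_mul]
    · simp
  have hright : (M.submatrix Fin.succ Fin.succ).det = 0 := by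
    rw [← hz, consecutiveMinor]
    congr 1
    ext p q
    simp [M, I, J, add_comm, add_left_comm]
  have hleft : (M.submatrix Fin.castSucc Fin.succ).det = consecutiveMinor w (n + 1) i j := by
    rw [consecutiveMinor]
    congr 1
  have hnonneg : 0 ≤ consecutiveMinor w (n + 1) i j :=
    hnn (n + 1) (fun p => i + p) (fun q => j + q)
      (fun p q h => Nat.add_lt_add_left h _) (fun p q h => Nat.add_lt_add_left h _)
      (fun p => by omega) (fun p => by omega)
  have key := desnanot_jacobi M
  rw [hleft, hright] at key
  nlinarith [mul_nonneg hM hinner.le, mul_nonneg hcorner.le hnonneg]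

/-- If some consecutive minor vanishes, then so does the corner minor of the same size. -/
theorem consecutiveMinor_corner_eq_zero
    (hlow : ∀ i j, j < i → w i j = 0) (hdiag : ∀ i < d, w i i = 1)
    (hnn : ∀ (m : ℕ) (I J : Fin m → ℕ), StrictMono I → StrictMono J → (∀ p, I p ≤ J p) →
      (∀ p, J p < d) → 0 ≤ (of fun p q => w (I p) (J q)).det)
    (hpos : ∀ (I J : Fin n → ℕ), StrictMono I → StrictMono J → (∀ p, I p ≤ J p) →
      (∀ p, J p < d) → 0 < (of fun p q => w (I p) (J q)).det)
    {i j : ℕ} (hij : i ≤ j) (hj : j + n < d) (hz : consecutiveMinor w (n + 1) i j = 0) :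
    consecutiveMinor w (n + 1) 0 (d - (n + 1)) = 0 := by
  have hlast : consecutiveMinor w (n + 1) i (d - (n + 1)) = 0 := by
    refine Nat.le_induction (P := fun c _ => c + n < d → consecutiveMinor w (n + 1) i c = 0)
      (fun _ => hz) (fun c hc ih hcd => ?_) (d - (n + 1)) (by omega : j ≤ _) (by omega)
    exact consecutiveMinor_succ_right_eq_zero hlow hdiag hnn hpos (hij.trans hc) (by omega)
      (ih (by omega))
  have hid : i ≤ d - (n + 1) := by omega
  clear hz hij
  induction i with
  | zero => exact hlast
  | succ i ih =>
    exact ih (consecutiveMinor_of_succ_left_eq_zero hlow hdiag hnn hpos hid (by omega) hlast)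
      (by omega)

end

/-- Lemma A.2 of the paper. Let `u` be a totally nonnegative
upper triangular unipotent matrix, `1 ≤ k ≤ d`, and suppose every non-trivial
`ℓ × ℓ` minor of `u` with `ℓ < k` is positive. If some non-trivial `k × k`
minor `det (u.submatrix I J)` of `u` with `I` and `J` consecutive vanishes,
then the top-right corner `k × k` minor of `u` vanishes. -/
theorem corner_minor_eq_zero_of_consecutive_minor_eq_zero {d : ℕ}
    (u : Matrix (Fin d) (Fin d) ℝ) (hu : UTUnipotent u) (hnn : TotallyNonneg u)
    (k : ℕ) (hk1 : 1 ≤ k) (hk2 : k ≤ d)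
    (hsmall : ∀ ℓ : ℕ, ℓ < k → ∀ I J : Fin ℓ → Fin d,
      StrictMono I → StrictMono J → (∀ p, I p ≤ J p) →
      0 < (u.submatrix I J).det)
    (I J : Fin k → Fin d) (hI : Consecutive I) (hJ : Consecutive J)
    (hIJ : ∀ p, I p ≤ J p) (hz : (u.submatrix I J).det = 0) :
    (u.submatrix (cornerI k hk2) (cornerJ k hk2)).det = 0 := by
  obtain ⟨n, rfl⟩ : ∃ n, k = n + 1 := ⟨k - 1, by omega⟩
  let w : ℕ → ℕ → ℝ := fun i j => if h : i < d ∧ j < d then u ⟨i, h.1⟩ ⟨j, h.2⟩ else 0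
  have w_val : ∀ i j : Fin d, w i j = u i j := fun i j => by simp [w]
  have det_w : ∀ {m : ℕ} (I J : Fin m → Fin d),
      (of fun p q => w (I p) (J q)).det = (u.submatrix I J).det := fun I J => by
    congr 1
    ext p q
    exact w_val _ _
  have lift_minor : ∀ {m : ℕ} (I J : Fin m → ℕ), StrictMono I → StrictMono J →
      (∀ p, I p ≤ J p) → (∀ p, J p < d) → ∃ I' J' : Fin m → Fin d, StrictMono I' ∧ StrictMono J' ∧
        (∀ p, I' p ≤ J' p) ∧ (of fun p q => w (I p) (J q)).det = (u.submatrix I' J').det :=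
    fun I J hI hJ hIJ hJd => ⟨fun p => ⟨I p, (hIJ p).trans_lt (hJd p)⟩, fun p => ⟨J p, hJd p⟩,
      fun _ _ h => hI h, fun _ _ h => hJ h, hIJ,
      det_w (fun p => ⟨I p, (hIJ p).trans_lt (hJd p)⟩) fun p => ⟨J p, hJd p⟩⟩
  have hlow : ∀ i j, j < i → w i j = 0 := fun i j hji => by
    simp only [w]
    split_ifs with h
    · exact hu.1 _ _ hji
    · rfl
  have hdiag : ∀ i < d, w i i = 1 := fun i hi => (w_val ⟨i, hi⟩ ⟨i, hi⟩).trans (hu.2 _)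
  have hI' : ∀ p, (I p : ℕ) = I 0 + p := fun p => by simpa using hI p 0
  have hJ' : ∀ p, (J p : ℕ) = J 0 + p := fun p => by simpa using hJ p 0
  have corner := consecutiveMinor_corner_eq_zero (n := n) (i := I 0) (j := J 0) hlow hdiag
    (fun m I J hI hJ hIJ hJd => by
      obtain ⟨I', J', hI', hJ', hIJ', hdet⟩ := lift_minor I J hI hJ hIJ hJd
      rw [hdet]
      rcases Nat.eq_zero_or_pos m with rfl | hm
      · simp
      · exact hnn m hm (by simpa using Fintype.card_le_of_injective J' hJ'.injective) I' J'
          hI' hJ' hIJ')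
    (fun I J hI hJ hIJ hJd => by
      obtain ⟨I', J', hI', hJ', hIJ', hdet⟩ := lift_minor I J hI hJ hIJ hJd
      rw [hdet]
      exact hsmall n n.lt_succ_self I' J' hI' hJ' hIJ')
    (hIJ 0) (by
      have hlast := (J (Fin.last n)).isLt
      rwa [hJ', Fin.val_last] at hlast)
    (by
      rw [← hz, ← det_w]
      refine congrArg det (Matrix.ext fun p q => ?_)
      simp only [of_apply]
      rw [← hI' p, ← hJ' q])
  rw [← det_w]
  simpa [consecutiveMinor, cornerI, cornerJ] using corner
end
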